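/- Let W = (w_{ij}) be a symmetric N × N real matrix (N ≥ 2) with nonnegative entries and zero diagonal, strengths s_i = Σ_j w_{ij}, total strength s = Σ_i s_i, and Laplacian L = S − W. Suppose L has eigenvalues 0 = θ_1 < θ_2 ≤ … ≤ θ_N with orthonormal eigenvectors φ_1,…,φ_N, where φ_1 = (1/√N)(1,…,1)ᵀ. Define T_{ij} = Σ_{z=1}^N s_z Σ_{k=2}^N (1/θ_k)·(φ_{kj}² − φ_{ki}φ_{kj} − φ_{kj}φ_{kz} + φ_{ki}φ_{kz}). Then the global mean hitting time satisfies ⟨T⟩ := (1/(N(N−1)))·Σ_{j=1}^N Σ_{i=1}^N T_{ij} = (s/(N−1))·Σ_{k=2}^N 1/θ_k. -/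

import Mathlib

open Finset

/-- For a vector `u` with zero sum, the cross terms vanish when the spectral summand of a hitting
time is summed over all source and target nodes. -/
theorem sum_sum_hitting_summand {ι : Type*} [Fintype ι] (u : ι → ℝ) (hu : ∑ i, u i = 0) (c : ℝ) :
    ∑ j, ∑ i, (u j ^ 2 - u i * u j - u j * c + u i * c) = Fintype.card ι * ∑ j, u j ^ 2 := by
  simp [Finset.sum_add_distrib, Finset.sum_sub_distrib, ← Finset.sum_mul, ← Finset.mul_sum, hu]

/-- A vector orthogonal to a nonzero constant vector has zero sum. -/
theorem sum_eq_zero_of_sum_const_mul_eq_zero {ι : Type*} [Fintype ι] (u : ι → ℝ) {a : ℝ}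
    (ha : a ≠ 0) (h : ∑ i, a * u i = 0) : ∑ i, u i = 0 := by
  rw [← Finset.mul_sum] at h
  exact (mul_eq_zero.mp h).resolve_left ha

/-- Spectral formula for the global mean hitting time of the random walk on a weighted
graph: `⟨T⟩ = (1/(N(N-1))) ∑_j ∑_i T_{ij} = (s/(N-1)) ∑_{k ≥ 2} 1/θ_k`. -/
theorem weighted_global_mean_hitting_time (N : ℕ) [NeZero N] (hN : 2 ≤ N)
    (W : Matrix (Fin N) (Fin N) ℝ)
    (hSymm : ∀ i j, W i j = W j i)
    (hnn : ∀ i j, 0 ≤ W i j)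
    (hdiag : ∀ i, W i i = 0)
    (s : Fin N → ℝ) (hs : ∀ i, s i = ∑ j, W i j)
    (stot : ℝ) (hstot : stot = ∑ i, s i)
    (θ : Fin N → ℝ) (φ : Fin N → Fin N → ℝ)
    (hθ0 : θ 0 = 0) (hθpos : ∀ k, k ≠ 0 → 0 < θ k) (hθmono : Monotone θ)
    (heig : ∀ k, (Matrix.diagonal s - W).mulVec (φ k) = θ k • φ k)
    (horth : ∀ k l, (∑ z, φ k z * φ l z) = if k = l then 1 else 0)
    (hφ0 : ∀ z, φ 0 z = 1 / Real.sqrt N)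
    (T : Fin N → Fin N → ℝ)
    (hT : ∀ i j, T i j = ∑ z, s z * ∑ k ∈ Finset.univ \ {0}, (1 / θ k) *
      (φ k j ^ 2 - φ k i * φ k j - φ k j * φ k z + φ k i * φ k z)) :
    (1 / ((N : ℝ) * ((N : ℝ) - 1))) * ∑ j, ∑ i, T i j
      = (stot / ((N : ℝ) - 1)) * ∑ k ∈ Finset.univ \ {0}, 1 / θ k := by
  have hN0 : (N : ℝ) ≠ 0 := NeZero.ne _
  have hsum : ∀ k, k ≠ 0 → ∑ z, φ k z = 0 := by
    intro k hk
    refine sum_eq_zero_of_sum_const_mul_eq_zero (φ k) (a := 1 / Real.sqrt N) (by positivity) ?_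
    simpa [hφ0, hk.symm] using horth 0 k
  have hsq : ∀ k, ∑ z, φ k z ^ 2 = 1 := fun k => by simpa [sq] using horth k k
  have key : ∑ j, ∑ i, T i j = N * (stot * ∑ k ∈ Finset.univ \ {0}, 1 / θ k) := by
    calc ∑ j, ∑ i, T i j
        = ∑ z, s z * ∑ k ∈ Finset.univ \ {0}, (1 / θ k) *
            ∑ j, ∑ i, (φ k j ^ 2 - φ k i * φ k j - φ k j * φ k z + φ k i * φ k z) := by
          simp_rw [hT, Finset.mul_sum]
          refine (Finset.sum_congr rfl fun j _ => Finset.sum_comm).trans (Finset.sum_comm.trans ?_)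
          refine Finset.sum_congr rfl fun z _ => ?_
          exact (Finset.sum_congr rfl fun j _ => Finset.sum_comm).trans Finset.sum_comm
      _ = ∑ z, s z * ∑ k ∈ Finset.univ \ {0}, (1 / θ k) * N := by
          refine Finset.sum_congr rfl fun z _ => congrArg _ (Finset.sum_congr rfl fun k hk => ?_)
          rw [sum_sum_hitting_summand _ (hsum k (by simpa using hk)), hsq]
          simp
      _ = N * (stot * ∑ k ∈ Finset.univ \ {0}, 1 / θ k) := by
          rw [← Finset.sum_mul, ← Finset.sum_mul, ← hstot]
          ring
  rw [key]
  field_simp
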